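/- Let K be an infinite compact subset of ℝ^d. Then the set of measures μ ∈ P(K) such that for every q < 0 the upper L^q-dimension of μ equals +∞ is residual in P(K) (it contains a dense G_δ set). -/

import Mathlib

open MeasureTheory Filter Metric Set Topology

noncomputable section

/-- `ℝ^d` with the Euclidean metric. -/
abbrev Euc (d : ℕ) : Type := EuclideanSpace ℝ (Fin d)

/-- The largest number of pairwise disjoint balls of radius `r` with centers in `E`. -/
noncomputable def packingNumber {X : Type*} [MetricSpace X] (E : Set X) (r : ℝ) : ℕ :=
  sSup {n : ℕ | ∃ c : Fin n → X, (∀ i, c i ∈ E) ∧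
    Pairwise fun i j => Disjoint (ball (c i) r) (ball (c j) r)}

/-- The smallest number of balls of radius `r` needed to cover `E`. -/
noncomputable def coveringNumber {X : Type*} [MetricSpace X] (E : Set X) (r : ℝ) : ℕ :=
  sInf {n : ℕ | ∃ c : Fin n → X, E ⊆ ⋃ i, ball (c i) r}

/-- Upper box (Minkowski) dimension. -/
noncomputable def upperBoxDim {X : Type*} [MetricSpace X] (E : Set X) : EReal :=
  limsup (fun r : ℝ => ((Real.log (coveringNumber E r : ℝ) / (-Real.log r) : ℝ) : EReal))
    (𝓝[>] (0:ℝ))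

/-- Lower box (Minkowski) dimension. -/
noncomputable def lowerBoxDim {X : Type*} [MetricSpace X] (E : Set X) : EReal :=
  liminf (fun r : ℝ => ((Real.log (coveringNumber E r : ℝ) / (-Real.log r) : ℝ) : EReal))
    (𝓝[>] (0:ℝ))

/-- Packing dimension, defined as the modified upper box dimension. -/
noncomputable def packingDim {X : Type*} [MetricSpace X] (E : Set X) : EReal :=
  ⨅ (F : ℕ → Set X) (_ : E ⊆ ⋃ n, F n), ⨆ n, upperBoxDim (F n)

/-- The local uniform upper box dimension. -/
noncomputable def locUnifUpperBoxDim {X : Type*} [MetricSpace X] (K : Set X) : EReal :=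
  ⨅ (N : ℕ) (_ : 1 ≤ N) (x : Fin N → X) (_ : ∀ i, x i ∈ K) (r₀ : ℝ) (_ : 0 < r₀),
    limsup (fun r : ℝ =>
      ((⨅ i : Fin N, Real.log (packingNumber (K ∩ ball (x i) r₀) r : ℝ) / (-Real.log r) : ℝ)
        : EReal)) (𝓝[>] (0:ℝ))

/-- The convex upper box dimension. -/
noncomputable def convUpperBoxDim {X : Type*} [MetricSpace X] (K : Set X) : EReal :=
  ⨅ (N : ℕ) (_ : 1 ≤ N) (x : Fin N → X) (_ : ∀ i, x i ∈ K) (ρ : ℝ) (_ : 0 < ρ)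
    (p : Fin N → ℝ) (_ : ∀ i, 0 < p i) (_ : ∑ i, p i = 1),
    limsup (fun r : ℝ =>
      (((∑ i, p i * Real.log (packingNumber (K ∩ ball (x i) ρ) r : ℝ)) / (-Real.log r) : ℝ)
        : EReal)) (𝓝[>] (0:ℝ))

/-- The maximal convex upper box dimension. -/
noncomputable def convUpperBoxDimMax {X : Type*} [MetricSpace X] (K : Set X) : EReal :=
  ⨆ (y : X) (_ : y ∈ K) (ρ : ℝ) (_ : 0 < ρ), convUpperBoxDim (K ∩ ball y ρ)

/-- `I_μ(r,q)`, with the logarithmic convention at `q = 1`. -/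
noncomputable def Iq {X : Type*} [MetricSpace X] [MeasurableSpace X]
    (μ : Measure X) (r q : ℝ) : ℝ :=
  if q = 1 then ∫ x, Real.log ((μ (ball x r)).toReal) ∂μ
  else ∫ x, ((μ (ball x r)).toReal) ^ (q - 1) ∂μ

/-- The quantity whose `liminf`/`limsup` as `r → 0⁺` gives the lower/upper `L^q`-dimensions. -/
noncomputable def Dq {X : Type*} [MetricSpace X] [MeasurableSpace X]
    (μ : Measure X) (r q : ℝ) : ℝ :=
  if q = 1 then Iq μ r 1 / Real.log r
  else (1 / (q - 1)) * (Real.log (Iq μ r q) / Real.log r)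

/-- The upper `L^q`-dimension of a measure. -/
noncomputable def upperDim {X : Type*} [MetricSpace X] [MeasurableSpace X]
    (μ : Measure X) (q : ℝ) : EReal :=
  limsup (fun r : ℝ => ((Dq μ r q : ℝ) : EReal)) (𝓝[>] (0:ℝ))

/-- The lower `L^q`-dimension of a measure. -/
noncomputable def lowerDim {X : Type*} [MetricSpace X] [MeasurableSpace X]
    (μ : Measure X) (q : ℝ) : EReal :=
  liminf (fun r : ℝ => ((Dq μ r q : ℝ) : EReal)) (𝓝[>] (0:ℝ))

/-- The (topological) support of a measure. -/
noncomputable def msupport {X : Type*} [MetricSpace X] [MeasurableSpace X]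
    (μ : Measure X) : Set X :=
  {x | ∀ r > (0:ℝ), 0 < μ (ball x r)}

/-- The upper `L^∞`-dimension of a measure. -/
noncomputable def upperDimInfty {X : Type*} [MetricSpace X] [MeasurableSpace X]
    (μ : Measure X) : EReal :=
  limsup (fun r : ℝ =>
    ((Real.log (⨆ x ∈ msupport μ, (μ (ball x r)).toReal) / Real.log r : ℝ) : EReal))
    (𝓝[>] (0:ℝ))

/-- The lower `L^∞`-dimension of a measure. -/
noncomputable def lowerDimInfty {X : Type*} [MetricSpace X] [MeasurableSpace X]
    (μ : Measure X) : EReal :=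
  liminf (fun r : ℝ =>
    ((Real.log (⨆ x ∈ msupport μ, (μ (ball x r)).toReal) / Real.log r : ℝ) : EReal))
    (𝓝[>] (0:ℝ))

/-- The upper `L^{-∞}`-dimension of a measure. -/
noncomputable def upperDimNegInfty {X : Type*} [MetricSpace X] [MeasurableSpace X]
    (μ : Measure X) : EReal :=
  limsup (fun r : ℝ =>
    ((Real.log (⨅ x ∈ msupport μ, (μ (ball x r)).toReal) / Real.log r : ℝ) : EReal))
    (𝓝[>] (0:ℝ))

/-- The lower `L^{-∞}`-dimension of a measure. -/
noncomputable def lowerDimNegInfty {X : Type*} [MetricSpace X] [MeasurableSpace X]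
    (μ : Measure X) : EReal :=
  liminf (fun r : ℝ =>
    ((Real.log (⨅ x ∈ msupport μ, (μ (ball x r)).toReal) / Real.log r : ℝ) : EReal))
    (𝓝[>] (0:ℝ))

/-- The half-closed dyadic cube of side `2^{-n}` indexed by `k`. -/
noncomputable def dyadicCube (d n : ℕ) (k : Fin d → ℤ) : Set (Euc d) :=
  {x | ∀ j, (k j : ℝ) / 2 ^ n ≤ x j ∧ x j < ((k j : ℝ) + 1) / 2 ^ n}

/-- `K_n`: the union of the half-closed dyadic cubes of side `2^{-n}` meeting `K`. -/
noncomputable def dyadicHull (d : ℕ) (K : Set (Euc d)) (n : ℕ) : Set (Euc d) :=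
  ⋃ (k : Fin d → ℤ) (_ : (dyadicCube d n k ∩ K).Nonempty), dyadicCube d n k

/-- The number of connected components of a set. -/
noncomputable def numComponents {X : Type*} [TopologicalSpace X] (S : Set X) : ℕ :=
  Nat.card {C : Set X // ∃ x ∈ S, C = connectedComponentIn S x}

/-- The box separation index `bsi(K)`. -/
noncomputable def bsi (d : ℕ) (K : Set (Euc d)) : ℝ :=
  liminf (fun n : ℕ =>
    Real.log (numComponents (dyadicHull d K n) : ℝ) / (n * Real.log 2)) atTop

/-- The Fortet–Mourier distance between two measures. -/
noncomputable def FMdist {X : Type*} [MetricSpace X] [MeasurableSpace X]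
    (μ ν : Measure X) : ℝ :=
  ⨆ f : {f : X → ℝ // LipschitzWith 1 f ∧ ∀ x, |f x| ≤ 1},
    |∫ x, f.1 x ∂μ - ∫ x, f.1 x ∂ν|


section TypicalMeasure

variable {X : Type*} [MetricSpace X] [MeasurableSpace X] [BorelSpace X]

/-- Probability measures having, at some scale `r < 1/(n+2)`, a ball of radius `2r` of measure
less than `r^(n+1)` at least half of which is carried by the concentric ball of radius `r/2`. -/
def thinBallSet (X : Type*) [MetricSpace X] [MeasurableSpace X] (n : ℕ) :
    Set (ProbabilityMeasure X) :=
  {μ | ∃ (x : X) (r : ℝ), 0 < r ∧ r < 1 / (n + 2) ∧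
    (μ : Measure X) (closedBall x (2 * r)) < ENNReal.ofReal (r ^ (n + 1)) ∧
    ENNReal.ofReal (r ^ (n + 1) / 2) < (μ : Measure X) (ball x (r / 2))}

lemma isOpen_setOf_lt_measure {G : Set X} (hG : IsOpen G) (c : ENNReal) :
    IsOpen {μ : ProbabilityMeasure X | c < (μ : Measure X) G} := by
  refine isOpen_iff_mem_nhds.2 fun μ hμ => ?_
  exact eventually_lt_of_lt_liminf
    (hμ.trans_le (ProbabilityMeasure.le_liminf_measure_open_of_tendsto tendsto_id hG))

lemma isOpen_setOf_measure_lt {F : Set X} (hF : IsClosed F) (c : ENNReal) :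
    IsOpen {μ : ProbabilityMeasure X | (μ : Measure X) F < c} := by
  refine isOpen_iff_mem_nhds.2 fun μ hμ => ?_
  exact eventually_lt_of_limsup_lt
    ((ProbabilityMeasure.limsup_measure_closed_le_of_tendsto tendsto_id hF).trans_lt hμ)

lemma isOpen_thinBallSet (n : ℕ) : IsOpen (thinBallSet X n) := by
  have : thinBallSet X n = ⋃ (x : X) (r : ℝ) (_ : 0 < r ∧ r < 1 / (n + 2)),
      {μ : ProbabilityMeasure X |
        (μ : Measure X) (closedBall x (2 * r)) < ENNReal.ofReal (r ^ (n + 1))} ∩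
      {μ | ENNReal.ofReal (r ^ (n + 1) / 2) < (μ : Measure X) (ball x (r / 2))} := by
    ext μ
    simp only [thinBallSet, mem_ofPred_eq, mem_iUnion, mem_inter_iff, exists_prop, and_assoc]
  rw [this]
  exact isOpen_iUnion fun x => isOpen_iUnion fun r => isOpen_iUnion fun _ =>
    (isOpen_setOf_measure_lt isClosed_closedBall _).inter (isOpen_setOf_lt_measure isOpen_ball _)

/-- The convex combination `(1 - t) g_* μ + t δ_x`. -/
def mapMixDirac (μ : ProbabilityMeasure X) {g : X → X} (hg : Measurable g) (x : X)
    (t : unitInterval) : ProbabilityMeasure X :=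
  ⟨ENNReal.ofReal (1 - t) • Measure.map g (μ : Measure X) +
      ENNReal.ofReal t • Measure.dirac x, by
    have := Measure.isProbabilityMeasure_map (μ := (μ : Measure X)) hg.aemeasurable
    refine ⟨?_⟩
    simp only [Measure.coe_add, Measure.coe_smul, Pi.add_apply, Pi.smul_apply, measure_univ,
      smul_eq_mul, mul_one]
    rw [← ENNReal.ofReal_add (by linarith [t.2.2]) t.2.1]
    simp⟩

lemma tendsto_mapMixDirac (μ : ProbabilityMeasure X) {g : ℕ → X → X}
    (hg : ∀ k, Measurable (g k)) (hg' : ∀ z, Tendsto (fun k => g k z) atTop (𝓝 z))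
    (x : ℕ → X) {t : ℕ → unitInterval} (ht : Tendsto (fun k => (t k : ℝ)) atTop (𝓝 0)) :
    Tendsto (fun k => mapMixDirac μ (hg k) (x k) (t k)) atTop (𝓝 μ) := by
  refine ProbabilityMeasure.tendsto_iff_forall_integral_tendsto.2 fun f => ?_
  have hint (k : ℕ) : ∫ z, f z ∂(mapMixDirac μ (hg k) (x k) (t k) : Measure X) =
      (1 - t k) * ∫ z, f (g k z) ∂(μ : Measure X) + t k * f (x k) := by
    have hp := Measure.isProbabilityMeasure_map (μ := (μ : Measure X)) (hg k).aemeasurable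
    change ∫ z, f z ∂(ENNReal.ofReal (1 - t k) • Measure.map (g k) (μ : Measure X) +
      ENNReal.ofReal (t k) • Measure.dirac (x k)) = _
    rw [integral_add_measure ((f.integrable _).smul_measure ENNReal.ofReal_ne_top)
        ((f.integrable _).smul_measure ENNReal.ofReal_ne_top), integral_smul_measure,
      integral_smul_measure, integral_dirac,
      integral_map (hg k).aemeasurable f.continuous.aestronglyMeasurable,
      ENNReal.toReal_ofReal (by linarith [(t k).2.2]), ENNReal.toReal_ofReal (t k).2.1]
    rfl
  simp_rw [hint]
  have h1 : Tendsto (fun k => ∫ z, f (g k z) ∂(μ : Measure X)) atTop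
      (𝓝 (∫ z, f z ∂(μ : Measure X))) := by
    refine tendsto_integral_of_dominated_convergence (fun _ => ‖f‖)
      (fun k => (f.continuous.measurable.comp (hg k)).aestronglyMeasurable)
      (integrable_const _) (fun k => Eventually.of_forall fun z => f.norm_coe_le_norm _)
      (Eventually.of_forall fun z => (f.continuous.tendsto z).comp (hg' z))
  have h2 : Tendsto (fun k => t k * f (x k)) atTop (𝓝 0) := by
    refine squeeze_zero_norm (a := fun k => t k * ‖f‖) (fun k => ?_) (by simpa using ht.mul_const _)
    rw [norm_mul, Real.norm_of_nonneg (t k).2.1]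
    exact mul_le_mul_of_nonneg_left (f.norm_coe_le_norm _) (t k).2.1
  simpa using ((ht.const_sub 1).mul h1).add h2

variable [CompactSpace X]

lemma measurable_measure_ball (μ : Measure X) [SFinite μ] (r : ℝ) :
    Measurable fun x => μ (ball x r) := by
  have hs : MeasurableSet {p : X × X | dist p.2 p.1 < r} :=
    (isOpen_lt (by fun_prop) continuous_const).measurableSet
  exact measurable_measure_prodMk_left hs

lemma integrable_measure_ball_rpow (μ : Measure X) [IsFiniteMeasure μ] {r p : ℝ} (hr : 0 < r)
    (hp : p < 0) : Integrable (fun x => (μ (ball x r)).toReal ^ p) μ := by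
  obtain ⟨t, -, htf, ht⟩ := (isCompact_univ (X := X)).finite_cover_balls (half_pos hr)
  have hmeas : Measurable fun x => (μ (ball x r)).toReal ^ p :=
    (measurable_measure_ball μ r).ennreal_toReal.pow_const p
  refine Integrable.of_bound hmeas.aestronglyMeasurable
    (∑ y ∈ htf.toFinset, (μ (ball y (r / 2))).toReal ^ p) ?_
  have hae : ∀ᵐ x ∂μ, ∀ y ∈ t, μ (ball y (r / 2)) = 0 → x ∉ ball y (r / 2) := by
    refine (ae_ball_iff htf.countable).2 fun y _ => ?_
    by_cases h : μ (ball y (r / 2)) = 0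
    · filter_upwards [measure_eq_zero_iff_ae_notMem.1 h] with x hx _ using hx
    · exact Eventually.of_forall fun x h' => absurd h' h
  filter_upwards [hae] with x hx
  obtain ⟨y, hyt, hxy⟩ := mem_iUnion₂.1 (ht (mem_univ x))
  have hpos : 0 < (μ (ball y (r / 2))).toReal :=
    ENNReal.toReal_pos (fun h => hx y hyt h hxy) (measure_ne_top _ _)
  have hsub : ball y (r / 2) ⊆ ball x r := by
    refine ball_subset_ball' ?_
    rw [mem_ball, dist_comm] at hxy
    linarith
  rw [Real.norm_of_nonneg (by positivity)]
  calc (μ (ball x r)).toReal ^ p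
      ≤ (μ (ball y (r / 2))).toReal ^ p :=
        Real.rpow_le_rpow_of_nonpos hpos (measureReal_mono hsub) hp.le
    _ ≤ _ := Finset.single_le_sum
        (f := fun y => (μ (ball y (r / 2))).toReal ^ p) (fun i _ => by positivity)
        (htf.mem_toFinset.2 hyt)

/-- A ball of small measure that is concentrated near its centre forces `I_μ(r,q)` to be large. -/
lemma le_Iq_of_measure_ball (μ : Measure X) [IsFiniteMeasure μ] {r q m : ℝ} {x : X} (hr : 0 < r)
    (hq : q < 0) (hm : 0 < m) (h1 : μ (closedBall x (2 * r)) < ENNReal.ofReal m)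
    (h2 : ENNReal.ofReal (m / 2) < μ (ball x (r / 2))) :
    m ^ q / 2 ≤ Iq μ r q := by
  have hp : q - 1 < 0 := by linarith
  have h1' : (μ (closedBall x (2 * r))).toReal ≤ m :=
    (ENNReal.toReal_lt_of_lt_ofReal h1).le
  have h2' : m / 2 ≤ (μ (ball x (r / 2))).toReal :=
    (ENNReal.ofReal_le_iff_le_toReal (measure_ne_top _ _)).1 h2.le
  have hint := integrable_measure_ball_rpow μ hr hp
  have key : ∀ z ∈ ball x (r / 2), m ^ (q - 1) ≤ (μ (ball z r)).toReal ^ (q - 1) := by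
    intro z hz
    rw [mem_ball] at hz
    have ha : ball z r ⊆ closedBall x (2 * r) :=
      ball_subset_closedBall.trans (closedBall_subset_closedBall' (by linarith))
    have hb : ball x (r / 2) ⊆ ball z r :=
      ball_subset_ball' (by rw [dist_comm] at hz; linarith)
    refine Real.rpow_le_rpow_of_nonpos ?_ ((measureReal_mono ha).trans h1') hp.le
    exact (half_pos hm).trans_le (h2'.trans (measureReal_mono hb))
  rw [Iq, if_neg (by linarith)]
  calc m ^ q / 2 = m ^ (q - 1) * (m / 2) := by
        rw [Real.rpow_sub_one hm.ne']; field_simp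
    _ ≤ m ^ (q - 1) * μ.real (ball x (r / 2)) :=
        mul_le_mul_of_nonneg_left h2' (by positivity)
    _ ≤ ∫ z in ball x (r / 2), (μ (ball z r)).toReal ^ (q - 1) ∂μ :=
        setIntegral_ge_of_const_le_real measurableSet_ball (measure_ne_top _ _) key
          hint.integrableOn
    _ ≤ ∫ z, (μ (ball z r)).toReal ^ (q - 1) ∂μ :=
        setIntegral_le_integral hint (Eventually.of_forall fun z => by positivity)

lemma le_Dq_of_measure_ball (μ : Measure X) [IsFiniteMeasure μ] {r q : ℝ} {x : X} {n : ℕ}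
    (hr : 0 < r) (hr' : r < 1 / 2) (hq : q < 0)
    (h1 : μ (closedBall x (2 * r)) < ENNReal.ofReal (r ^ n))
    (h2 : ENNReal.ofReal (r ^ n / 2) < μ (ball x (r / 2))) :
    (-q * n - 1) / (1 - q) ≤ Dq μ r q := by
  have hm : 0 < r ^ n := pow_pos hr n
  have hI := le_Iq_of_measure_ball μ hr hq hm h1 h2
  have hlog : Real.log r < -Real.log 2 := by
    rw [← Real.log_inv]; exact Real.log_lt_log hr (by simpa using hr')
  have hlog2 := Real.log_pos one_lt_two
  have hL : q * (n * Real.log r) - Real.log 2 ≤ Real.log (Iq μ r q) := by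
    rw [← Real.log_pow, ← Real.log_rpow hm, ← Real.log_div (by positivity) two_ne_zero]
    exact Real.log_le_log (by positivity) hI
  rw [Dq, if_neg (by linarith), one_div_mul_eq_div, div_div,
    show Real.log r * (q - 1) = (-Real.log r) * (1 - q) by ring, ← div_div]
  refine div_le_div_of_nonneg_right ?_ (by linarith)
  rw [le_div_iff₀ (by linarith)]
  linarith

lemma upperDim_eq_top_of_forall_mem_thinBallSet {μ : ProbabilityMeasure X}
    (hμ : ∀ n, μ ∈ thinBallSet X n) {q : ℝ} (hq : q < 0) :
    upperDim (μ : Measure X) q = ⊤ := by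
  refine top_le_iff.1 (EReal.ge_of_forall_gt_iff_ge.1 fun C _ => ?_)
  refine le_limsup_of_frequently_le ?_
  rw [frequently_nhdsWithin_iff, Metric.nhds_basis_ball.frequently_iff]
  intro ε hε
  obtain ⟨n₁, hn₁⟩ := exists_nat_gt (1 / ε)
  obtain ⟨n₂, hn₂⟩ := exists_nat_gt ((C * (1 - q) + 1) / -q)
  obtain ⟨x, r, hr, hrn, h1, h2⟩ := hμ (max n₁ n₂)
  have hm₁ : (n₁ : ℝ) ≤ (max n₁ n₂ : ℕ) := by exact_mod_cast le_max_left _ _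
  have hm₂ : (n₂ : ℝ) ≤ (max n₁ n₂ : ℕ) := by exact_mod_cast le_max_right _ _
  generalize max n₁ n₂ = n at *
  have hn : (0 : ℝ) ≤ n := n.cast_nonneg
  have hrε : r < ε := by
    refine hrn.trans ?_
    rw [div_lt_comm₀ (by positivity) hε]
    linarith
  refine ⟨r, ?_, ?_, hr⟩
  · rw [mem_ball, Real.dist_0_eq_abs, abs_of_pos hr]; exact hrε
  · have hr2 : r < 1 / 2 := hrn.trans_le (one_div_le_one_div_of_le two_pos (by linarith))
    refine EReal.coe_le_coe_iff.2 (le_trans ?_ (le_Dq_of_measure_ball _ hr hr2 hq h1 h2))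
    rw [le_div_iff₀ (by linarith)]
    rw [div_lt_iff₀ (by linarith)] at hn₂
    push_cast
    nlinarith

lemma dense_thinBallSet [Infinite X] (n : ℕ) : Dense (thinBallSet X n) := by
  classical
  intro μ
  obtain ⟨a, ha⟩ := exists_nhds_ne_neBot X
  have hδ (k : ℕ) : (0 : ℝ) < 1 / (k + 1) := Nat.one_div_pos_of_nat
  have hex (k : ℕ) : ∃ x, x ≠ a ∧ dist x a < 1 / (k + 1) / 2 := by
    have : {a}ᶜ ∩ ball a (1 / (k + 1) / 2) ∈ 𝓝[≠] a :=
      inter_mem self_mem_nhdsWithin (mem_nhdsWithin_of_mem_nhds (ball_mem_nhds a (half_pos (hδ k))))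
    obtain ⟨x, hx, hxa⟩ := ha.nonempty_of_mem this
    exact ⟨x, hx, hxa⟩
  choose x hxa hx using hex
  set r : ℕ → ℝ := fun k => dist (x k) a / 3 with hr_def
  have hr (k : ℕ) : 0 < r k := div_pos (dist_pos.2 (hxa k)) three_pos
  have hrδ (k : ℕ) : r k < 1 / (k + 1) := by
    have := hx k; have := hδ k; simp only [hr_def]; linarith
  have hr1 (k : ℕ) : r k ≤ 1 :=
    (hrδ k).le.trans ((div_le_one (by positivity)).2 (by linarith [k.cast_nonneg (α := ℝ)]))
  have hr0 : Tendsto r atTop (𝓝 0) :=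
    squeeze_zero (fun k => (hr k).le) (fun k => (hrδ k).le) tendsto_one_div_add_atTop_nhds_zero_nat
  let t : ℕ → unitInterval := fun k => ⟨3 / 4 * r k ^ (n + 1), by
    have := hr k; positivity, by
    have := pow_le_one₀ (n := n + 1) (hr k).le (hr1 k); linarith⟩
  have ht : Tendsto (fun k => (t k : ℝ)) atTop (𝓝 0) := by
    simpa using (hr0.pow (n + 1)).const_mul (3 / 4)
  let g : ℕ → X → X := fun k => (ball a (1 / (k + 1))).piecewise (fun _ => a) id
  have hg (k : ℕ) : Measurable (g k) :=
    Measurable.piecewise measurableSet_ball measurable_const measurable_id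
  have hg' (z : X) : Tendsto (fun k => g k z) atTop (𝓝 z) := by
    rw [tendsto_iff_dist_tendsto_zero]
    refine squeeze_zero (fun _ => dist_nonneg) (fun k => ?_)
      (tendsto_one_div_add_atTop_nhds_zero_nat (𝕜 := ℝ))
    by_cases hz : z ∈ ball a (1 / (k + 1) : ℝ)
    · simp only [g, piecewise_eq_of_mem _ _ _ hz]
      rw [dist_comm]; exact (mem_ball.1 hz).le
    · simp only [g, piecewise_eq_of_notMem _ _ _ hz, id, dist_self]
      exact (hδ k).le
  refine mem_closure_of_tendsto (tendsto_mapMixDirac μ hg hg' x ht) ?_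
  filter_upwards [hr0.eventually_lt_const (show (0 : ℝ) < 1 / (n + 2) by positivity)] with k hk
  have hpow : 0 < r k ^ (n + 1) := pow_pos (hr k) _
  have hval (S : Set X) (hS : MeasurableSet S) (hxS : x k ∈ S) :
      (mapMixDirac μ (hg k) (x k) (t k) : Measure X) S =
        ENNReal.ofReal (1 - t k) * (μ : Measure X) (g k ⁻¹' S) + ENNReal.ofReal (t k) := by
    change (ENNReal.ofReal (1 - t k) • Measure.map (g k) (μ : Measure X) +
      ENNReal.ofReal (t k) • Measure.dirac (x k)) S = _
    simp [Measure.map_apply (hg k) hS, hxS]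
  refine ⟨x k, r k, hr k, hk, ?_, ?_⟩
  · have hempty : g k ⁻¹' closedBall (x k) (2 * r k) = ∅ := by
      refine eq_empty_of_forall_notMem fun z hz => ?_
      rw [mem_preimage, mem_closedBall] at hz
      have hk3 : 3 * r k = dist (x k) a := by simp only [hr_def]; ring
      by_cases hza : z ∈ ball a (1 / (k + 1) : ℝ)
      · simp only [g, piecewise_eq_of_mem _ _ _ hza] at hz
        rw [dist_comm] at hz
        linarith [hr k]
      · simp only [g, piecewise_eq_of_notMem _ _ _ hza, id] at hz
        refine hza (mem_ball.2 ?_)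
        linarith [dist_triangle z (x k) a, hx k, hr k]
    rw [hval _ measurableSet_closedBall (mem_closedBall_self (by linarith [hr k])), hempty,
      measure_empty, mul_zero, zero_add]
    refine (ENNReal.ofReal_lt_ofReal_iff hpow).2 ?_
    change 3 / 4 * r k ^ (n + 1) < _
    linarith
  · rw [hval _ measurableSet_ball (mem_ball_self (half_pos (hr k)))]
    refine lt_of_lt_of_le ?_ le_add_self
    have htk : (t k : ℝ) = 3 / 4 * r k ^ (n + 1) := rfl
    refine (ENNReal.ofReal_lt_ofReal_iff (by rw [htk]; positivity)).2 ?_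
    linarith

end TypicalMeasure

/-- A typical measure on an infinite compact `K ⊆ ℝ^d` has upper `L^q`-dimension equal to `+∞`,
simultaneously for all `q < 0`. -/
theorem typical_upperDim_eq_top (d : ℕ) (K : Set (Euc d))
    (hK : IsCompact K) (hKinf : K.Infinite) :
    ∃ G : Set (ProbabilityMeasure ↥K),
      G ⊆ {μ : ProbabilityMeasure ↥K |
        ∀ q : ℝ, q < 0 → upperDim (μ : Measure ↥K) q = (⊤ : EReal)} ∧
      Dense G ∧ IsGδ G := by
  have : CompactSpace K := isCompact_iff_compactSpace.1 hK
  have : Infinite K := hKinf.to_subtype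
  exact ⟨⋂ n, thinBallSet K n,
    fun μ hμ q hq => upperDim_eq_top_of_forall_mem_thinBallSet (mem_iInter.1 hμ) hq,
    dense_iInter_of_isOpen isOpen_thinBallSet dense_thinBallSet,
    IsGδ.iInter_of_isOpen isOpen_thinBallSet⟩


end
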